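/- arXiv:2602.23185 — 3 statements merged into one kernel-verified Lean document; each statement's English description precedes it below -/
import Mathlib

section
/- Let 2 ≤ k ≤ n. There exists a constant C₂ > 0 depending only on n and k such that for every λ ∈ Γ_k one has σ_{k-1}(λ) ≥ C₂ · σ₁(λ)^{1/(k-1)} · σ_k(λ)^{(k-2)/(k-1)}. -/
/-- The `m`-th elementary symmetric polynomial of `λ ∈ ℝⁿ`. -/
noncomputable def esymm (n m : ℕ) (lam : Fin n → ℝ) : ℝ :=
  ∑ s ∈ Finset.powersetCard m (Finset.univ : Finset (Fin n)), ∏ i ∈ s, lam i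

/-- The Gårding cone `Γ_k`. -/
def GardingCone (n k : ℕ) : Set (Fin n → ℝ) :=
  {lam | ∀ j, 1 ≤ j → j ≤ k → 0 < esymm n j lam}

open Polynomial in
/-- Rolle: the derivative of a real-rooted polynomial is real-rooted. -/
theorem splits_derivative_real {p : ℝ[X]} (hp : p.Splits) : (derivative p).Splits := by
  rw [splits_iff_card_roots]
  have h := card_roots_le_derivative p
  have h₁ := splits_iff_card_roots.1 hp
  have h₂ := card_roots' (derivative p)
  have h₃ := natDegree_derivative_le p
  rcases Nat.eq_zero_or_pos p.natDegree with h0 | h0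
  · rw [h0] at h₃
    omega
  · omega

open Polynomial in
/-- Laguerre's inequality for real-rooted polynomials. -/
theorem eval_mul_eval_derivative_derivative_le {p : ℝ[X]} (hp : p.Splits) (x : ℝ) :
    p.eval x * (derivative (derivative p)).eval x ≤ (derivative p).eval x ^ 2 := by
  have key : ∀ s : Multiset ℝ,
      ((s.map fun a => X - C a).prod).eval x *
        (derivative (derivative (s.map fun a => X - C a).prod)).eval x ≤
      (derivative (s.map fun a => X - C a).prod).eval x ^ 2 := by
    intro s
    induction s using Multiset.induction_on with
    | empty => simp
    | cons a s ih =>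
      rw [Multiset.map_cons, Multiset.prod_cons]
      generalize (s.map fun a => X - C a).prod = q at ih ⊢
      simp only [derivative_mul, derivative_sub, derivative_X, derivative_C, sub_zero, one_mul,
        derivative_add, eval_add, eval_mul, eval_sub, eval_X, eval_C]
      nlinarith [mul_le_mul_of_nonneg_left ih (sq_nonneg (x - a)), sq_nonneg (q.eval x)]
  rw [hp.eq_prod_roots]
  simp only [derivative_C_mul, eval_mul, eval_C]
  nlinarith [mul_le_mul_of_nonneg_left (key p.roots) (sq_nonneg p.leadingCoeff)]

open Polynomial in
/-- Newton's inequality, in a weak form, for the coefficients of a real-rooted polynomial. -/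
theorem coeff_mul_coeff_le_sq {p : ℝ[X]} (hp : p.Splits) (i : ℕ) :
    ((i : ℝ) + 2) * (p.coeff i * p.coeff (i + 2)) ≤ (i + 1) * p.coeff (i + 1) ^ 2 := by
  have hs : (derivative^[i] p).Splits := by
    induction i with
    | zero => exact hp
    | succ i ih =>
      rw [Function.iterate_succ_apply']
      exact splits_derivative_real ih
  have h := eval_mul_eval_derivative_derivative_le hs 0
  rw [← Function.iterate_succ_apply' derivative, ← Function.iterate_succ_apply' derivative] at h
  simp only [← coeff_zero_eq_eval_zero, coeff_iterate_derivative, zero_add,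
    Nat.descFactorial_self, nsmul_eq_mul, Nat.factorial_succ, Nat.succ_eq_add_one] at h
  push_cast at h
  have hpos : (0 : ℝ) < (i.factorial : ℝ) ^ 2 * (i + 1) := by positivity
  refine le_of_mul_le_mul_left ?_ hpos
  rw [show i + 1 + 1 = i + 2 from rfl] at h
  linarith

theorem esymm_mul_esymm_le_sq {n m : ℕ} (hm : m + 2 ≤ n) (lam : Fin n → ℝ)
    (h₀ : 0 ≤ esymm n m lam * esymm n (m + 2) lam) :
    esymm n m lam * esymm n (m + 2) lam ≤ esymm n (m + 1) lam ^ 2 := by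
  have hs : (∏ i : Fin n, (Polynomial.X + Polynomial.C (lam i))).Splits :=
    Polynomial.Splits.prod fun i _ => Polynomial.Splits.X_add_C (lam i)
  have hc : ∀ j ≤ n,
      (∏ i : Fin n, (Polynomial.X + Polynomial.C (lam i))).coeff (n - j) = esymm n j lam := by
    intro j hj
    rw [Finset.prod_X_add_C_coeff _ _ (by simp), esymm, Finset.card_univ, Fintype.card_fin,
      Nat.sub_sub_self hj]
  have h := coeff_mul_coeff_le_sq hs (n - (m + 2))
  rw [show n - (m + 2) + 2 = n - m by omega, show n - (m + 2) + 1 = n - (m + 1) by omega,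
    hc _ hm, hc _ (by omega), hc _ (by omega)] at h
  have hi : (0 : ℝ) < ((n - (m + 2) : ℕ) : ℝ) + 1 := by positivity
  refine le_of_mul_le_mul_left ?_ hi
  linarith

/-- A positive log-concave sequence satisfies `s₁ s_{m+2}^m ≤ s_{m+1}^{m+1}`. -/
theorem mul_pow_le_pow_of_log_concave {s : ℕ → ℝ} {N : ℕ} (hpos : ∀ j, 1 ≤ j → j ≤ N → 0 < s j)
    (hlc : ∀ j, 1 ≤ j → j + 2 ≤ N → s j * s (j + 2) ≤ s (j + 1) ^ 2) (m : ℕ) (hm : m + 2 ≤ N) :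
    s 1 * s (m + 2) ^ m ≤ s (m + 1) ^ (m + 1) := by
  induction m with
  | zero => simp
  | succ m ih =>
    have h₁ := hpos (m + 1) (by omega) (by omega)
    have h₂ := hpos (m + 2) (by omega) (by omega)
    have h₃ := hpos (m + 3) (by omega) (by omega)
    refine le_of_mul_le_mul_right ?_ (pow_pos h₂ m)
    calc s 1 * s (m + 3) ^ (m + 1) * s (m + 2) ^ m
        = s 1 * s (m + 2) ^ m * s (m + 3) ^ (m + 1) := by ring
      _ ≤ s (m + 1) ^ (m + 1) * s (m + 3) ^ (m + 1) := by
          gcongr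
          exact ih (by omega)
      _ = (s (m + 1) * s (m + 3)) ^ (m + 1) := by ring
      _ ≤ (s (m + 2) ^ 2) ^ (m + 1) := by
          gcongr
          exact hlc (m + 1) (by omega) hm
      _ = s (m + 2) ^ (m + 2) * s (m + 2) ^ m := by ring

/-- for `2 ≤ k ≤ n` there exists `C₂ > 0`, depending only on `n` and `k`,
such that `σ_{k-1}(λ) ≥ C₂ σ₁(λ)^{1/(k-1)} σ_k(λ)^{(k-2)/(k-1)}` for all `λ ∈ Γ_k`. -/
theorem stmt1 (n k : ℕ) (hk : 2 ≤ k) (hkn : k ≤ n) :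
    ∃ C₂ : ℝ, 0 < C₂ ∧ ∀ lam ∈ GardingCone n k,
      esymm n (k - 1) lam ≥
        C₂ * (esymm n 1 lam) ^ ((1 : ℝ) / ((k : ℝ) - 1)) *
          (esymm n k lam) ^ (((k : ℝ) - 2) / ((k : ℝ) - 1)) := by
  refine ⟨1, one_pos, fun lam hlam => ?_⟩
  obtain ⟨m, rfl⟩ := Nat.exists_eq_add_of_le' hk
  have h := mul_pow_le_pow_of_log_concave (s := fun j => esymm n j lam) hlam
    (fun j hj hjk => esymm_mul_esymm_le_sq (hjk.trans hkn) lam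
      (mul_pos (hlam j hj (by omega)) (hlam (j + 2) (by omega) hjk)).le) m le_rfl
  have h₁ := hlam 1 le_rfl (by omega)
  have h₂ : 0 < esymm n (m + 1) lam := hlam (m + 1) (by omega) (by omega)
  have h₃ := hlam (m + 2) (by omega) le_rfl
  have hm : (0 : ℝ) < (m : ℝ) + 1 := by positivity
  have e₁ : ((m + 2 : ℕ) : ℝ) - 1 = m + 1 := by push_cast; ring
  have e₂ : ((m + 2 : ℕ) : ℝ) - 2 = m := by push_cast; ring
  rw [e₁, e₂, one_mul, ge_iff_le, show m + 2 - 1 = m + 1 from rfl]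
  calc esymm n 1 lam ^ (1 / ((m : ℝ) + 1)) * esymm n (m + 2) lam ^ ((m : ℝ) / (m + 1))
      = (esymm n 1 lam * esymm n (m + 2) lam ^ m) ^ (1 / ((m : ℝ) + 1)) := by
        rw [Real.mul_rpow h₁.le (by positivity), ← Real.rpow_natCast (esymm n (m + 2) lam),
          ← Real.rpow_mul h₃.le, mul_one_div]
    _ ≤ (esymm n (m + 1) lam ^ (m + 1)) ^ (1 / ((m : ℝ) + 1)) :=
        Real.rpow_le_rpow (by positivity) h (by positivity)
    _ = esymm n (m + 1) lam := by
        rw [← Real.rpow_natCast, ← Real.rpow_mul h₂.le, Nat.cast_succ,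
          mul_one_div_cancel hm.ne', Real.rpow_one]
end

section
/- Let 2 ≤ k ≤ n. There exists a constant θ > 0 depending only on n and k such that for every λ in the closure of the Gårding cone Γ_k with entries ordered λ₁ ≥ λ₂ ≥ ⋯ ≥ λ_n, one has σ_{k-1;k}(λ) ≥ θ · σ_{k-1}(λ). -/
/-- `σ_{m;i}(λ)`: the `m`-th elementary symmetric polynomial of `λ` with the entry
`λ_i` replaced by `0`. -/
noncomputable def esymmDel (n m : ℕ) (i : Fin n) (lam : Fin n → ℝ) : ℝ :=
  esymm n m (Function.update lam i 0)

/-- By Rolle's theorem, the derivative of a real-rooted polynomial is real-rooted. -/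
theorem Polynomial.Splits.derivative_real {p : Polynomial ℝ} (hp : p.Splits) :
    (Polynomial.derivative p).Splits := by
  rw [Polynomial.splits_iff_card_roots] at hp ⊢
  have h1 := Polynomial.card_roots_le_derivative p
  have h2 := Polynomial.card_roots' (Polynomial.derivative p)
  have h3 := Polynomial.natDegree_derivative_le p
  omega

/-- Laguerre's inequality for real-rooted polynomials. -/
theorem Polynomial.Splits.laguerre {p : Polynomial ℝ} (hp : p.Splits) (t : ℝ) :
    p.eval t * (Polynomial.derivative (Polynomial.derivative p)).eval t ≤
      (Polynomial.derivative p).eval t ^ 2 := by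
  obtain ⟨m, hm⟩ := Polynomial.splits_iff_exists_multiset.1 hp
  have key : ∀ m : Multiset ℝ, ∀ q : Polynomial ℝ,
      q = (m.map fun a => Polynomial.X - Polynomial.C a).prod →
      q.eval t * (Polynomial.derivative (Polynomial.derivative q)).eval t ≤
        (Polynomial.derivative q).eval t ^ 2 := by
    intro m
    induction m using Multiset.induction with
    | empty => rintro q rfl; simp
    | cons a m ih =>
      intro q hq
      have h := ih _ rfl
      rw [Multiset.map_cons, Multiset.prod_cons] at hq
      generalize (m.map fun a => Polynomial.X - Polynomial.C a).prod = r at h hq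
      subst hq
      simp only [Polynomial.derivative_mul, Polynomial.derivative_sub, Polynomial.derivative_X,
        Polynomial.derivative_C, Polynomial.derivative_add, Polynomial.eval_add,
        Polynomial.eval_mul, Polynomial.eval_sub, Polynomial.eval_X, Polynomial.eval_C,
        sub_zero, one_mul]
      nlinarith [mul_le_mul_of_nonneg_left h (sq_nonneg (t - a)), sq_nonneg (r.eval t)]
  have h := key m _ rfl
  rw [hm]
  simp only [Polynomial.derivative_C_mul, Polynomial.eval_C_mul]
  nlinarith [mul_le_mul_of_nonneg_left h (sq_nonneg p.leadingCoeff)]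

/-- A coefficient form of Newton's inequality for real-rooted polynomials. -/
theorem Polynomial.Splits.newton_coeff {p : Polynomial ℝ} (hp : p.Splits) (k : ℕ) :
    (k + 2) * (p.coeff k * p.coeff (k + 2)) ≤ (k + 1) * p.coeff (k + 1) ^ 2 := by
  have hs : (Polynomial.derivative^[k] p).Splits := by
    induction k with
    | zero => simpa using hp
    | succ k ih =>
      rw [Function.iterate_succ_apply']
      exact ih.derivative_real
  have h := hs.laguerre 0
  rw [← Function.iterate_succ_apply' (f := Polynomial.derivative),
    ← Function.iterate_succ_apply' (f := Polynomial.derivative)] at h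
  simp only [← Polynomial.coeff_zero_eq_eval_zero, Polynomial.coeff_iterate_derivative,
    zero_add, Nat.descFactorial_self, nsmul_eq_mul, Nat.factorial_succ, Nat.cast_mul,
    Nat.succ_eq_add_one, Nat.cast_add, Nat.cast_one] at h
  have hf : (0 : ℝ) < (k.factorial : ℝ) := by positivity
  have hc : (0 : ℝ) < (k.factorial : ℝ) ^ 2 * (k + 1) := by positivity
  refine le_of_mul_le_mul_left ?_ hc
  nlinarith [h]

namespace Multiset

theorem esymm_zero' (s : Multiset ℝ) : s.esymm 0 = 1 := by simp [esymm]

theorem esymm_cons_succ (a : ℝ) (s : Multiset ℝ) (k : ℕ) :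
    (a ::ₘ s).esymm (k + 1) = s.esymm (k + 1) + a * s.esymm k := by
  simp [esymm, powersetCard_cons, Multiset.sum_map_mul_left]

theorem esymm_zero_cons (s : Multiset ℝ) (k : ℕ) : ((0 : ℝ) ::ₘ s).esymm k = s.esymm k := by
  cases k with
  | zero => simp [esymm_zero']
  | succ k => simp [esymm_cons_succ]

theorem esymm_one' (s : Multiset ℝ) : s.esymm 1 = s.sum := by
  induction s using Multiset.induction with
  | empty => simp [esymm, powersetCard_zero_right]
  | cons a s ih => rw [esymm_cons_succ, ih, esymm_zero', sum_cons]; ring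

theorem coeff_prod_one_add_C_mul_X (s : Multiset ℝ) (k : ℕ) :
    ((s.map fun a => 1 + Polynomial.C a * Polynomial.X).prod).coeff k = s.esymm k := by
  induction s using Multiset.induction generalizing k with
  | empty =>
    cases k with
    | zero => simp [esymm_zero']
    | succ k => simp [esymm, powersetCard_zero_right, Polynomial.coeff_one]
  | cons a s ih =>
    rw [map_cons, prod_cons, add_mul, one_mul, Polynomial.coeff_add, mul_assoc,
      Polynomial.coeff_C_mul, ih]
    cases k with
    | zero => simp [esymm_zero']
    | succ k => rw [Polynomial.coeff_X_mul, ih, esymm_cons_succ]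

/-- Newton's inequality for elementary symmetric functions of real numbers of any sign. -/
theorem newton_esymm (s : Multiset ℝ) (k : ℕ) :
    (k + 2) * (s.esymm k * s.esymm (k + 2)) ≤ (k + 1) * s.esymm (k + 1) ^ 2 := by
  have h : ((s.map fun a => 1 + Polynomial.C a * Polynomial.X).prod).Splits := by
    refine Polynomial.Splits.multisetProd fun f hf => ?_
    obtain ⟨a, -, rfl⟩ := mem_map.1 hf
    refine Polynomial.Splits.of_natDegree_le_one ?_
    compute_degree
  simpa only [coeff_prod_one_add_C_mul_X] using h.newton_coeff k

/-- `s.esymmPos k` says that `s` lies in the Gårding cone `Γ_k`. -/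
def esymmPos (s : Multiset ℝ) (k : ℕ) : Prop := ∀ j ≤ k, 0 < s.esymm j

theorem esymmPos.mono {s : Multiset ℝ} {j k : ℕ} (h : s.esymmPos k) (hjk : j ≤ k) :
    s.esymmPos j := fun i hi => h i (hi.trans hjk)

/-- Deleting an entry maps `Γ_{k+1}` into `Γ_k`. -/
theorem esymmPos.of_cons {a : ℝ} {s : Multiset ℝ} {k : ℕ} (h : (a ::ₘ s).esymmPos (k + 1)) :
    s.esymmPos k := by
  intro j
  induction j with
  | zero => intro _; rw [esymm_zero']; exact one_pos
  | succ j ih =>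
    intro hj
    have h0 := ih (by omega)
    have h1 := h (j + 1) (by omega)
    have h2 := h (j + 1 + 1) (by omega)
    rw [esymm_cons_succ] at h1 h2
    by_contra! hneg
    have ha : 0 < a := by
      by_contra! ha
      nlinarith
    have hN := newton_esymm s j
    have hpos : 0 < s.esymm (j + 2) := by
      have : a * s.esymm (j + 1) ≤ 0 := mul_nonpos_of_nonneg_of_nonpos ha.le hneg
      have h2' : 0 < s.esymm (j + 2) + a * s.esymm (j + 1) := h2
      linarith
    have h2' : 0 < s.esymm (j + 2) + a * s.esymm (j + 1) := h2
    have hj0 : (0 : ℝ) ≤ j := j.cast_nonneg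
    have h3 : s.esymm (j + 1) ^ 2 ≤ s.esymm j * s.esymm (j + 2) := by
      nlinarith [mul_nonneg h0.le (by linarith : 0 ≤ s.esymm (j + 2) + a * s.esymm (j + 1)),
        mul_nonneg (neg_nonneg.2 hneg) h1.le]
    have h4 : 0 < s.esymm j * s.esymm (j + 2) := mul_pos h0 hpos
    nlinarith [mul_le_mul_of_nonneg_left h3 (by linarith : (0 : ℝ) ≤ j + 1)]

/-- The Gårding cone is preserved by increasing an entry. -/
theorem esymmPos.cons_mono {a b : ℝ} {s : Multiset ℝ} {k : ℕ} (h : (a ::ₘ s).esymmPos k)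
    (hab : a ≤ b) : (b ::ₘ s).esymmPos k := by
  intro j hj
  cases j with
  | zero => rw [esymm_zero']; exact one_pos
  | succ j =>
    have h1 := h _ hj
    have h2 := (h.mono hj).of_cons j le_rfl
    rw [esymm_cons_succ] at h1 ⊢
    nlinarith

theorem esymmPos.esymm_succ_le {s : Multiset ℝ} {k : ℕ} (h : s.esymmPos k) :
    s.esymm (k + 1) ≤ s.sum * s.esymm k := by
  induction k with
  | zero => rw [esymm_zero', zero_add, esymm_one', mul_one]
  | succ k ih =>
    have h0 := h k (by omega)
    have h1 := h (k + 1) le_rfl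
    have ih := ih (h.mono (by omega))
    have hN := newton_esymm s k
    have hk : (0 : ℝ) ≤ k := k.cast_nonneg
    have h2 : s.esymm k * s.esymm (k + 2) ≤ s.esymm (k + 1) ^ 2 := by
      by_contra! hlt
      nlinarith [sq_nonneg (s.esymm (k + 1))]
    refine le_of_mul_le_mul_left ?_ h0
    calc _ ≤ s.esymm (k + 1) ^ 2 := h2
      _ ≤ _ := by nlinarith

/-- Elementary estimate behind the induction step of `exists_le_esymm_of_esymmPos`. -/
theorem quadratic_lower_bound {p q r a x κ : ℝ} (hκ : 0 ≤ κ) (hp : 0 < p)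
    (hxa : x ≤ a) (hN : (κ + 2) * (p * r) ≤ (κ + 1) * q ^ 2) (h1 : 0 < q + a * p)
    (h2 : 0 < r + (a + x) * q + a * x * p) : a * p ≤ (κ + 3) * (q + a * p) := by
  rcases le_or_gt 0 q with hq | hq
  · nlinarith [mul_nonneg hκ h1.le]
  by_contra! hlt
  have h3 : 0 < p * r + (a + x) * (p * q) + a * x * p ^ 2 := by nlinarith [mul_pos hp h2]
  have h4 : q ^ 2 < (κ + 2) * ((q + a * p) * (q + x * p)) := by nlinarith
  have h5 : q + x * p ≤ q + a * p := by nlinarith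
  have h6 : q ^ 2 < (κ + 2) * (q + a * p) ^ 2 := by nlinarith [mul_le_mul_of_nonneg_left h5 h1.le]
  have h7 : (κ + 2) * (q + a * p) < -q := by linarith
  nlinarith [mul_pos (by linarith : 0 < κ + 2) h1]

/-- The Lin–Trudinger type inequality, for multisets: deleting the `(k+1)`-st largest entry `x` of
an element of `Γ_{k+1}` does not decrease `σ_k` by more than a constant factor. -/
theorem exists_le_esymm_of_esymmPos (N k : ℕ) :
    ∃ θ : ℝ, 0 < θ ∧ ∀ (u v : Multiset ℝ) (x : ℝ), card u = k → card (u + v) ≤ N →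
      (∀ a ∈ u, x ≤ a) → (∀ b ∈ v, b ≤ x) → (x ::ₘ (u + v)).esymmPos (k + 1) →
      θ * (x ::ₘ (u + v)).esymm k ≤ (u + v).esymm k := by
  induction k with
  | zero => exact ⟨1, one_pos, fun u v x _ _ _ _ _ => by simp [esymm_zero']⟩
  | succ k ih =>
    obtain ⟨θ, hθ, ih⟩ := ih
    refine ⟨θ / ((k + 3) * (N + 1)), by positivity, ?_⟩
    intro u v x hu hN hxu hxv hpos
    obtain ⟨a, hau, hmax⟩ : ∃ a ∈ u, ∀ b ∈ u, b ≤ a := by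
      have hne : u.toFinset.Nonempty := by
        rw [toFinset_nonempty]; rintro rfl; simp at hu
      refine ⟨u.toFinset.max' hne, mem_toFinset.1 (Finset.max'_mem _ _), fun b hb => ?_⟩
      exact Finset.le_max' _ _ (mem_toFinset.2 hb)
    obtain ⟨u, rfl⟩ := exists_cons_of_mem hau
    rw [card_cons, Nat.add_right_cancel_iff] at hu
    rw [cons_add] at hpos hN ⊢
    rw [card_cons] at hN
    have hxa : x ≤ a := hxu a (mem_cons_self a u)
    have hswap := cons_swap x a (u + v)
    have hle : ∀ b ∈ x ::ₘ (u + v), b ≤ a := by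
      intro b hb
      rcases mem_cons.1 hb with rfl | hb
      · exact hxa
      rcases mem_add.1 hb with hb | hb
      · exact hmax b (mem_cons_of_mem hb)
      · exact (hxv b hb).trans hxa
    have hposx : (x ::ₘ (u + v)).esymmPos (k + 1) := by
      rw [hswap] at hpos; exact hpos.of_cons
    have hposa : (a ::ₘ (u + v)).esymmPos (k + 1) := hpos.of_cons
    have hih := ih u v x hu (by omega) (fun b hb => hxu b (mem_cons_of_mem hb)) hxv hposx
    have hs := hposx 1 (by omega)
    rw [esymm_one'] at hs
    have hsum := sum_le_card_nsmul _ _ hle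
    rw [nsmul_eq_mul] at hsum
    have ha : 0 < a := by
      by_contra! h
      have := mul_nonpos_of_nonneg_of_nonpos (card (x ::ₘ (u + v))).cast_nonneg h
      linarith
    have hcard : (card (x ::ₘ (u + v)) : ℝ) ≤ N := by
      rw [card_cons]; exact_mod_cast hN
    have hM := (hposx.mono (Nat.le_succ k)).esymm_succ_le
    have h0 := hposx k (by omega)
    have hsumN : (x ::ₘ (u + v)).sum ≤ N * a :=
      hsum.trans (mul_le_mul_of_nonneg_right hcard ha.le)
    have hupper : (x ::ₘ a ::ₘ (u + v)).esymm (k + 1) ≤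
        (N + 1) * (a * (x ::ₘ (u + v)).esymm k) := by
      rw [hswap, esymm_cons_succ]
      nlinarith [mul_le_mul_of_nonneg_right hsumN h0.le]
    have h1 := hposa (k + 1) le_rfl
    have h2 := hpos (k + 1 + 1) le_rfl
    rw [esymm_cons_succ] at h1
    rw [esymm_cons_succ, esymm_cons_succ, esymm_cons_succ] at h2
    have hlower := quadratic_lower_bound k.cast_nonneg (hposx.of_cons k le_rfl) hxa
      (newton_esymm (u + v) k) h1 (by linarith)
    rw [← esymm_cons_succ] at hlower
    rw [div_mul_eq_mul_div, div_le_iff₀ (by positivity)]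
    calc θ * (x ::ₘ a ::ₘ (u + v)).esymm (k + 1)
        ≤ θ * ((N + 1) * (a * (x ::ₘ (u + v)).esymm k)) :=
          mul_le_mul_of_nonneg_left hupper hθ.le
      _ = (N + 1) * a * (θ * (x ::ₘ (u + v)).esymm k) := by ring
      _ ≤ (N + 1) * a * (u + v).esymm k := mul_le_mul_of_nonneg_left hih (by positivity)
      _ = (N + 1) * (a * (u + v).esymm k) := by ring
      _ ≤ (N + 1) * ((k + 3) * (a ::ₘ (u + v)).esymm (k + 1)) :=
          mul_le_mul_of_nonneg_left hlower (by positivity)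
      _ = _ := by ring

end Multiset

theorem esymm_eq_multiset_esymm (n m : ℕ) (lam : Fin n → ℝ) :
    esymm n m lam = ((Finset.univ : Finset (Fin n)).val.map lam).esymm m :=
  (Finset.esymm_map_val lam Finset.univ m).symm

theorem mem_GardingCone_iff {n k : ℕ} {lam : Fin n → ℝ} :
    lam ∈ GardingCone n k ↔ ((Finset.univ : Finset (Fin n)).val.map lam).esymmPos k := by
  simp only [GardingCone, Set.mem_ofPred_eq, esymm_eq_multiset_esymm, Multiset.esymmPos]
  refine ⟨fun h j hj => ?_, fun h j _ hj => h j hj⟩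
  rcases Nat.eq_zero_or_pos j with rfl | hj0
  · rw [Multiset.esymm_zero']; exact one_pos
  · exact h j hj0 hj

theorem map_univ_eq_cons {n : ℕ} (i : Fin n) (lam : Fin n → ℝ) :
    (Finset.univ : Finset (Fin n)).val.map lam =
      lam i ::ₘ (Finset.univ.erase i).val.map lam := by
  rw [← Multiset.map_cons, Finset.erase_val, Multiset.cons_erase (Finset.mem_univ i)]

theorem map_univ_update {n : ℕ} (i : Fin n) (b : ℝ) (lam : Fin n → ℝ) :
    (Finset.univ : Finset (Fin n)).val.map (Function.update lam i b) =
      b ::ₘ (Finset.univ.erase i).val.map lam := by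
  rw [map_univ_eq_cons i, Function.update_self]
  congr 1
  refine Multiset.map_congr rfl fun j hj => ?_
  have hj : j ∈ Finset.univ.erase i := hj
  exact Function.update_of_ne (Finset.ne_of_mem_erase hj) _ _

theorem map_erase_eq_add {n : ℕ} (i : Fin n) (lam : Fin n → ℝ) :
    (Finset.univ.erase i).val.map lam =
      (Finset.Iio i).val.map lam + (Finset.Ioi i).val.map lam := by
  have hd : Disjoint (Finset.Iio i) (Finset.Ioi i) := by
    rw [Finset.disjoint_left]
    intro j hj hj'
    exact lt_asymm (Finset.mem_Iio.1 hj) (Finset.mem_Ioi.1 hj')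
  have h : Finset.univ.erase i = (Finset.Iio i).disjUnion (Finset.Ioi i) hd := by
    ext j
    simp
  rw [h, Finset.disjUnion_val, Multiset.map_add]

/-- The Gårding cone is an upper set. -/
theorem isUpperSet_GardingCone (n k : ℕ) : IsUpperSet (GardingCone n k) := by
  intro lam mu hle hlam
  have key : ∀ S : Finset (Fin n), S.piecewise mu lam ∈ GardingCone n k := by
    intro S
    induction S using Finset.induction with
    | empty => simpa using hlam
    | insert i S hi ih =>
      rw [Finset.piecewise_insert, mem_GardingCone_iff, map_univ_update]
      rw [mem_GardingCone_iff, map_univ_eq_cons i] at ih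
      refine ih.cons_mono ?_
      rw [Finset.piecewise_eq_of_notMem _ _ _ hi]
      exact hle i
  simpa using key Finset.univ

theorem add_const_mem_GardingCone {n k : ℕ} {lam : Fin n → ℝ}
    (h : lam ∈ closure (GardingCone n k)) {ε : ℝ} (hε : 0 < ε) :
    (fun i => lam i + ε) ∈ GardingCone n k := by
  obtain ⟨mu, hmu, hd⟩ := Metric.mem_closure_iff.1 h ε hε
  refine isUpperSet_GardingCone n k (fun i => ?_) hmu
  have h1 := (dist_le_pi_dist lam mu i).trans_lt hd
  rw [Real.dist_eq, abs_lt] at h1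
  change mu i ≤ lam i + ε
  linarith

theorem continuous_esymm (n m : ℕ) : Continuous (esymm n m) := by
  unfold esymm
  fun_prop

theorem continuous_esymmDel (n m : ℕ) (i : Fin n) : Continuous (esymmDel n m i) :=
  (continuous_esymm n m).comp (continuous_id.update i continuous_const)

/-- for `2 ≤ k ≤ n` there is a universal `θ > 0` (depending only on `n, k`)
such that `σ_{k-1;k}(λ) ≥ θ σ_{k-1}(λ)` for every `λ` in the closure of `Γ_k` whose
entries are ordered decreasingly.  (The index `k` in `σ_{k-1;k}` is the `k`-th entry,
i.e. the entry `⟨k-1, _⟩` in `Fin n`.) -/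
theorem stmt4 (n k : ℕ) (hk : 2 ≤ k) (hkn : k ≤ n) :
    ∃ θ : ℝ, 0 < θ ∧ ∀ lam ∈ closure (GardingCone n k), Antitone lam →
      esymmDel n (k - 1) ⟨k - 1, by omega⟩ lam ≥ θ * esymm n (k - 1) lam := by
  obtain ⟨θ, hθ, H⟩ := Multiset.exists_le_esymm_of_esymmPos n (k - 1)
  refine ⟨θ, hθ, fun lam hlam hanti => ?_⟩
  set i : Fin n := ⟨k - 1, by omega⟩ with hi
  have hpos : ∀ ε > 0, θ * esymm n (k - 1) (fun j => lam j + ε) ≤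
      esymmDel n (k - 1) i (fun j => lam j + ε) := by
    intro ε hε
    have hmem := mem_GardingCone_iff.1 (add_const_mem_GardingCone hlam hε)
    rw [esymmDel, esymm_eq_multiset_esymm, esymm_eq_multiset_esymm, map_univ_update,
      Multiset.esymm_zero_cons]
    rw [map_univ_eq_cons i, map_erase_eq_add] at hmem ⊢
    refine H _ _ _ (by simp [hi]) ?_ ?_ ?_ (by rwa [Nat.sub_add_cancel (by omega)])
    · rw [← map_erase_eq_add, Multiset.card_map]
      exact (Finset.card_le_univ _).trans_eq (Fintype.card_fin n)
    · intro a ha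
      obtain ⟨j, hj, rfl⟩ := Multiset.mem_map.1 ha
      exact add_le_add_left (hanti (Finset.mem_Iio.1 hj).le) ε
    · intro b hb
      obtain ⟨j, hj, rfl⟩ := Multiset.mem_map.1 hb
      exact add_le_add_left (hanti (Finset.mem_Ioi.1 hj).le) ε
  have hshift : Continuous fun ε : ℝ => fun j => lam j + ε := by fun_prop
  have hl : Continuous fun ε : ℝ => θ * esymm n (k - 1) (fun j => lam j + ε) :=
    continuous_const.mul ((continuous_esymm n (k - 1)).comp hshift)
  have hr : Continuous fun ε : ℝ => esymmDel n (k - 1) i (fun j => lam j + ε) :=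
    (continuous_esymmDel n (k - 1) i).comp hshift
  have hlim := le_of_tendsto_of_tendsto
    ((hl.tendsto 0).mono_left nhdsWithin_le_nhds)
    ((hr.tendsto 0).mono_left nhdsWithin_le_nhds)
    (Filter.eventually_of_mem (self_mem_nhdsWithin : Set.Ioi (0 : ℝ) ∈ _) hpos)
  simpa using hlim
end

section
/- Let 1 ≤ k ≤ n. For every λ ∈ Γ_k and every μ in the closure of Γ_k, one has Σ_{i=1}^{n} σ_{k-1;i}(λ) · μ_i ≥ k · σ_k(λ)^{(k-1)/k} · σ_k(μ)^{1/k}; in particular Σ_{i=1}^{n} σ_{k-1;i}(λ) · μ_i ≥ 0. -/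
open Polynomial in
/-- Rolle's theorem: the derivative of a real-rooted polynomial is real-rooted. -/
theorem splits_derivative_of_real {f : ℝ[X]} (hf : f.Splits) : (derivative f).Splits := by
  rw [splits_iff_card_roots] at hf ⊢
  have h₁ := card_roots_le_derivative f
  have h₂ := card_roots' (derivative f)
  have h₃ := natDegree_derivative_le f
  rcases Nat.eq_zero_or_pos f.natDegree with h | h <;> omega

open Polynomial in
theorem two_mul_coeff_zero_mul_coeff_two_le {f : ℝ[X]} (hf : f.Splits) :
    2 * (f.coeff 0 * f.coeff 2) ≤ f.coeff 1 ^ 2 := by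
  induction hf using Submonoid.closure_induction_left with
  | one => simp [coeff_one]
  | mul_left x hx g _ ih =>
    rcases hx with ⟨a, rfl⟩ | ⟨a, rfl⟩
    · simp only [coeff_C_mul]
      nlinarith [mul_le_mul_of_nonneg_left ih (sq_nonneg a)]
    · have h₁ : ((X + C a) * g).coeff 1 = g.coeff 0 + a * g.coeff 1 := by
        simp [add_mul, coeff_X_mul g 0]
      have h₂ : ((X + C a) * g).coeff 2 = g.coeff 1 + a * g.coeff 2 := by
        simp [add_mul, coeff_X_mul g 1]
      have h₀ : ((X + C a) * g).coeff 0 = a * g.coeff 0 := by simp [add_mul]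
      rw [h₀, h₁, h₂]
      nlinarith [mul_le_mul_of_nonneg_left ih (sq_nonneg a), sq_nonneg (g.coeff 0)]

open Polynomial in
/-- Newton's inequality for consecutive coefficients of a real-rooted polynomial. -/
theorem coeff_mul_coeff_le_of_splits (m : ℕ) {f : ℝ[X]} (hf : f.Splits) :
    (m + 2) * (f.coeff m * f.coeff (m + 2)) ≤ (m + 1) * f.coeff (m + 1) ^ 2 := by
  induction m generalizing f with
  | zero => simpa using two_mul_coeff_zero_mul_coeff_two_le hf
  | succ m ih =>
    have h := ih (splits_derivative_of_real hf)
    simp only [coeff_derivative] at h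
    push_cast at h ⊢
    have hp : (0 : ℝ) < (m + 1) * (m + 2) := by positivity
    refine le_of_mul_le_mul_left ?_ hp
    ring_nf at h ⊢
    linarith

section ElementarySymmetric

variable {ι : Type*}

/-- The `m`-th elementary symmetric polynomial of the entries of `x` indexed by `S`. -/
noncomputable def esymmOn (S : Finset ι) (m : ℕ) (x : ι → ℝ) : ℝ :=
  ∑ s ∈ S.powersetCard m, ∏ i ∈ s, x i

@[simp] theorem esymmOn_zero (S : Finset ι) (x : ι → ℝ) : esymmOn S 0 x = 1 := by
  simp [esymmOn]

theorem esymmOn_congr {S : Finset ι} {x y : ι → ℝ} (m : ℕ) (h : ∀ i ∈ S, x i = y i) :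
    esymmOn S m x = esymmOn S m y :=
  Finset.sum_congr rfl fun _ hs => Finset.prod_congr rfl fun i hi =>
    h i ((Finset.mem_powersetCard.1 hs).1 hi)

theorem esymmOn_empty_succ (m : ℕ) (x : ι → ℝ) : esymmOn ∅ (m + 1) x = 0 := by
  rw [esymmOn, Finset.powersetCard_eq_empty.2 (by simp), Finset.sum_empty]

variable [DecidableEq ι]

/-- The derivative at `x` in the direction `y` of the `m`-th elementary symmetric polynomial of the
entries indexed by `S`. -/
noncomputable def esymmOnDeriv (S : Finset ι) : ℕ → (ι → ℝ) → (ι → ℝ) → ℝ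
  | 0, _, _ => 0
  | m + 1, x, y => ∑ i ∈ S, y i * esymmOn (S.erase i) m x

theorem esymmOn_insert {S : Finset ι} {a : ι} (ha : a ∉ S) (m : ℕ) (x : ι → ℝ) :
    esymmOn (insert a S) (m + 1) x = esymmOn S (m + 1) x + x a * esymmOn S m x := by
  have hmem : ∀ s ∈ S.powersetCard m, a ∉ s := fun s hs h =>
    ha ((Finset.mem_powersetCard.1 hs).1 h)
  unfold esymmOn
  rw [Finset.powersetCard_succ_insert ha, Finset.sum_union, Finset.sum_image, Finset.mul_sum]
  · congr 1
    exact Finset.sum_congr rfl fun s hs => Finset.prod_insert (hmem s hs)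
  · intro s hs t ht hst
    rw [← Finset.erase_insert (hmem s hs), ← Finset.erase_insert (hmem t ht)]
    exact congrArg (Finset.erase · a) hst
  · rw [Finset.disjoint_left]
    intro s hs hs'
    obtain ⟨t, _, rfl⟩ := Finset.mem_image.1 hs'
    exact ha ((Finset.mem_powersetCard.1 hs).1 (Finset.mem_insert_self a t))

theorem esymmOn_succ_eq_erase {S : Finset ι} {a : ι} (ha : a ∈ S) (m : ℕ) (x : ι → ℝ) :
    esymmOn S (m + 1) x = esymmOn (S.erase a) (m + 1) x + x a * esymmOn (S.erase a) m x := by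
  simpa [Finset.insert_erase ha] using esymmOn_insert (Finset.notMem_erase a S) m x

theorem sum_mul_esymmOn_erase (S : Finset ι) (m : ℕ) (x : ι → ℝ) :
    ∑ i ∈ S, x i * esymmOn (S.erase i) m x = (m + 1) * esymmOn S (m + 1) x := by
  induction S using Finset.induction_on generalizing m with
  | empty => simp [esymmOn_empty_succ]
  | insert a S ha ih =>
    have hne : ∀ i ∈ S, a ≠ i := fun i hi h => ha (h ▸ hi)
    rw [Finset.sum_insert ha, Finset.erase_insert ha, esymmOn_insert ha]
    cases m with
    | zero =>
      have h := ih 0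
      simp only [esymmOn_zero] at h ⊢
      rw [h]
      push_cast
      ring
    | succ m =>
      have h : ∀ i ∈ S, x i * esymmOn ((insert a S).erase i) (m + 1) x =
          x i * esymmOn (S.erase i) (m + 1) x + x a * (x i * esymmOn (S.erase i) m x) := by
        intro i hi
        rw [Finset.erase_insert_of_ne (hne i hi),
          esymmOn_insert (fun h => ha (Finset.mem_of_mem_erase h))]
        ring
      rw [Finset.sum_congr rfl h, Finset.sum_add_distrib, ← Finset.mul_sum, ih, ih]
      push_cast
      ring

theorem esymmOnDeriv_succ_eq_erase {S : Finset ι} {a : ι} (ha : a ∈ S) (m : ℕ) (x y : ι → ℝ) :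
    esymmOnDeriv S (m + 1) x y = esymmOnDeriv (S.erase a) (m + 1) x y +
      y a * esymmOn (S.erase a) m x + x a * esymmOnDeriv (S.erase a) m x y := by
  cases m with
  | zero => simp [esymmOnDeriv, Finset.sum_erase_add _ _ ha]
  | succ m =>
    simp only [esymmOnDeriv]
    have h : ∀ i ∈ S.erase a, y i * esymmOn (S.erase i) (m + 1) x =
        y i * esymmOn ((S.erase a).erase i) (m + 1) x +
          x a * (y i * esymmOn ((S.erase a).erase i) m x) := by
      intro i hi
      rw [esymmOn_succ_eq_erase
        (Finset.mem_erase.2 ⟨(Finset.ne_of_mem_erase hi).symm, ha⟩) m x,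
        Finset.erase_right_comm]
      ring
    rw [← Finset.sum_erase_add _ _ ha, Finset.sum_congr rfl h, Finset.sum_add_distrib,
      ← Finset.mul_sum]
    ring

theorem sum_esymmOnDeriv_erase (S : Finset ι) (m : ℕ) (x y : ι → ℝ) :
    ∑ i ∈ S, (y i * esymmOn (S.erase i) m x + x i * esymmOnDeriv (S.erase i) m x y) =
      (m + 1) * esymmOnDeriv S (m + 1) x y := by
  cases m with
  | zero => simp [esymmOnDeriv]
  | succ m =>
    have h : ∑ i ∈ S, x i * esymmOnDeriv (S.erase i) (m + 1) x y =
        (m + 1) * esymmOnDeriv S (m + 2) x y := by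
      simp only [esymmOnDeriv, Finset.mul_sum]
      rw [Finset.sum_comm' (t' := S) (s' := fun j => S.erase j)
        (by intro i j; simp only [Finset.mem_erase]; tauto)]
      refine Finset.sum_congr rfl fun j _ => ?_
      rw [mul_left_comm, ← sum_mul_esymmOn_erase, Finset.mul_sum]
      refine Finset.sum_congr rfl fun i _ => ?_
      rw [Finset.erase_right_comm]
      ring
    rw [Finset.sum_add_distrib, h]
    simp only [esymmOnDeriv]
    push_cast
    ring

open Polynomial in
theorem coeff_prod_one_add_C_mul_X (S : Finset ι) (m : ℕ) (x : ι → ℝ) :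
    (∏ i ∈ S, (1 + C (x i) * X)).coeff m = esymmOn S m x := by
  induction S using Finset.induction_on generalizing m with
  | empty =>
    cases m with
    | zero => simp
    | succ m => simp [esymmOn_empty_succ, coeff_one]
  | insert a S ha ih =>
    rw [Finset.prod_insert ha]
    cases m with
    | zero => simp [add_mul, mul_assoc, ih]
    | succ m => simp [add_mul, mul_assoc, ih, esymmOn_insert ha]

/-- Newton's inequality, without the binomial normalisation. -/
theorem esymmOn_mul_esymmOn_le_sq (S : Finset ι) (m : ℕ) (x : ι → ℝ) :
    esymmOn S m x * esymmOn S (m + 2) x ≤ esymmOn S (m + 1) x ^ 2 := by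
  have hs : (∏ i ∈ S, (1 + Polynomial.C (x i) * Polynomial.X)).Splits :=
    Polynomial.Splits.prod fun i _ => Polynomial.Splits.of_natDegree_le_one (by compute_degree)
  have h := coeff_mul_coeff_le_of_splits m hs
  simp only [coeff_prod_one_add_C_mul_X] at h
  have hm : (0 : ℝ) ≤ m := m.cast_nonneg
  nlinarith [sq_nonneg (esymmOn S (m + 1) x)]

/-- Deleting an entry maps the cone `Γ_{k+1}` into `Γ_k`. -/
theorem esymmOn_erase_pos {S : Finset ι} {a : ι} (ha : a ∈ S) {x : ι → ℝ} (k : ℕ)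
    (h : ∀ j ≤ k + 1, 0 < esymmOn S j x) : ∀ j ≤ k, 0 < esymmOn (S.erase a) j x := by
  induction k with
  | zero => intro j hj; simp [Nat.le_zero.1 hj]
  | succ k ih =>
    intro j hj
    have ih' := ih fun j hj => h j (by omega)
    rcases Nat.lt_or_ge j (k + 1) with hlt | hge
    · exact ih' j (by omega)
    obtain rfl : j = k + 1 := by omega
    have h₁ := h (k + 1) (by omega)
    have h₂ := h (k + 2) le_rfl
    have hk := ih' k le_rfl
    have hN := esymmOn_mul_esymmOn_le_sq (S.erase a) k x
    rw [esymmOn_succ_eq_erase ha] at h₁ h₂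
    by_contra! hneg
    set p := esymmOn (S.erase a) k x
    set q := esymmOn (S.erase a) (k + 1) x
    set r := esymmOn (S.erase a) (k + 2) x
    have hx : 0 < x a := by
      by_contra! hx
      nlinarith
    have hr : 0 < r := by nlinarith
    have e₁ : 0 < r * (q + x a * p) := mul_pos hr h₁
    have e₂ : 0 ≤ -q * (r + x a * q) := mul_nonneg (by linarith) h₂.le
    have e₃ : 0 ≤ x a * (q ^ 2 - p * r) := mul_nonneg hx.le (by linarith)
    nlinarith

/-- Concavity of the quotient `σ_{m+1} / σ_m` on `Γ_m`, in tangent form with cleared denominators. -/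
theorem esymmOn_quotient_tangent (S : Finset ι) (m : ℕ) (x y : ι → ℝ)
    (hx : ∀ j ≤ m, 0 < esymmOn S j x) (hy : ∀ j ≤ m, 0 < esymmOn S j y) :
    esymmOn S (m + 1) y * esymmOn S m x ^ 2 ≤
      (esymmOnDeriv S (m + 1) x y * esymmOn S m x -
        esymmOn S (m + 1) x * esymmOnDeriv S m x y) * esymmOn S m y := by
  induction m generalizing S with
  | zero =>
    have h := sum_mul_esymmOn_erase S 0 y
    simp only [esymmOn_zero, mul_one, Nat.cast_zero, zero_add, one_mul] at h
    simp [esymmOnDeriv, h]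
  | succ m ih =>
    have hterm : ∀ i ∈ S, y i * esymmOn (S.erase i) (m + 1) y * esymmOn S (m + 1) x ^ 2 ≤
        ((y i * esymmOn (S.erase i) (m + 1) x + x i * esymmOnDeriv (S.erase i) (m + 1) x y) *
            esymmOn S (m + 1) x -
          x i * esymmOn (S.erase i) (m + 1) x * esymmOnDeriv S (m + 1) x y) *
            esymmOn S (m + 1) y := by
      intro i hi
      have hx' := esymmOn_erase_pos hi m hx
      have hy' := esymmOn_erase_pos hi m hy
      have h := ih (S.erase i) hx' hy'
      have hB := hy (m + 1) le_rfl
      have hv := hy' m le_rfl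
      rw [esymmOn_succ_eq_erase hi m y] at hB
      rw [esymmOn_succ_eq_erase hi m x, esymmOn_succ_eq_erase hi m y,
        esymmOnDeriv_succ_eq_erase hi m x y]
      generalize esymmOn (S.erase i) (m + 1) x = p at *
      generalize esymmOn (S.erase i) m x = q at *
      generalize esymmOn (S.erase i) (m + 1) y = u at *
      generalize esymmOn (S.erase i) m y = v at *
      generalize esymmOnDeriv (S.erase i) (m + 1) x y = P at *
      generalize esymmOnDeriv (S.erase i) m x y = Q at *
      have e := mul_le_mul_of_nonneg_left h (mul_nonneg hB.le (sq_nonneg (x i)))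
      refine le_of_mul_le_mul_right ?_ hv
      linear_combination e + sq_nonneg (x i * u * q - y i * v * p)
    have hsum := Finset.sum_le_sum hterm
    rw [← Finset.sum_mul, ← Finset.sum_mul, Finset.sum_sub_distrib, ← Finset.sum_mul,
      ← Finset.sum_mul, sum_esymmOnDeriv_erase, sum_mul_esymmOn_erase,
      sum_mul_esymmOn_erase] at hsum
    have hm : (0 : ℝ) < (m + 1 : ℕ) + 1 := by positivity
    refine le_of_mul_le_mul_left ?_ hm
    linear_combination hsum

theorem sum_ratio_le_esymmOnDeriv_div (S : Finset ι) (k : ℕ) (x y : ι → ℝ)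
    (hx : ∀ j ≤ k, 0 < esymmOn S j x) (hy : ∀ j ≤ k, 0 < esymmOn S j y) :
    ∑ j ∈ Finset.range k, (esymmOn S (j + 1) y / esymmOn S (j + 1) x) /
      (esymmOn S j y / esymmOn S j x) ≤ esymmOnDeriv S k x y / esymmOn S k x := by
  induction k with
  | zero => simp [esymmOnDeriv]
  | succ k ih =>
    have h := ih (fun j hj => hx j (by omega)) (fun j hj => hy j (by omega))
    have ht := esymmOn_quotient_tangent S k x y (fun j hj => hx j (by omega))
      (fun j hj => hy j (by omega))
    have hx₀ := hx k (by omega)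
    have hx₁ := hx (k + 1) le_rfl
    have hy₀ := hy k (by omega)
    have hstep : (esymmOn S (k + 1) y / esymmOn S (k + 1) x) / (esymmOn S k y / esymmOn S k x) ≤
        esymmOnDeriv S (k + 1) x y / esymmOn S (k + 1) x -
          esymmOnDeriv S k x y / esymmOn S k x := by
      rw [div_div_div_eq, div_sub_div _ _ hx₁.ne' hx₀.ne', div_le_div_iff₀ (by positivity)
        (by positivity)]
      linear_combination esymmOn S (k + 1) x * ht
    rw [Finset.sum_range_succ]
    linarith

/-- Gårding's inequality on the open cone `Γ_k`. -/
theorem mul_rpow_mul_rpow_le_esymmOnDeriv (S : Finset ι) {k : ℕ} (hk : 1 ≤ k) (x y : ι → ℝ)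
    (hx : ∀ j ≤ k, 0 < esymmOn S j x) (hy : ∀ j ≤ k, 0 < esymmOn S j y) :
    (k : ℝ) * esymmOn S k x ^ (((k : ℝ) - 1) / k) * esymmOn S k y ^ ((1 : ℝ) / k) ≤
      esymmOnDeriv S k x y := by
  have hk₀ : (0 : ℝ) < k := by exact_mod_cast hk
  have hA := hx k le_rfl
  have hB := hy k le_rfl
  set r : ℕ → ℝ := fun j => esymmOn S j y / esymmOn S j x with hr
  have hrpos : ∀ j ≤ k, 0 < r j := fun j hj => div_pos (hy j hj) (hx j hj)
  have hprod : ∀ m ≤ k, ∏ j ∈ Finset.range m, r (j + 1) / r j = r m := by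
    intro m hm
    induction m with
    | zero => simp [hr]
    | succ m ih =>
      rw [Finset.prod_range_succ, ih (by omega), mul_div_cancel₀ _ (hrpos m (by omega)).ne']
  have hq : ∀ j ∈ Finset.range k, 0 ≤ r (j + 1) / r j := fun j hj => by
    have := Finset.mem_range.1 hj
    exact (div_pos (hrpos _ (by omega)) (hrpos _ (by omega))).le
  have hamgm := Real.geom_mean_le_arith_mean_weighted (Finset.range k) (fun _ => (1 : ℝ) / k)
    (fun j => r (j + 1) / r j) (fun _ _ => by positivity) (by simp [hk₀.ne']) hq
  rw [Real.finsetProd_rpow _ _ hq, hprod k le_rfl, ← Finset.mul_sum] at hamgm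
  have hsum := sum_ratio_le_esymmOnDeriv_div S k x y hx hy
  have hle : (k : ℝ) * r k ^ ((1 : ℝ) / k) ≤ esymmOnDeriv S k x y / esymmOn S k x := by
    refine le_trans ?_ hsum
    calc (k : ℝ) * r k ^ ((1 : ℝ) / k) ≤ k * (1 / k * ∑ j ∈ Finset.range k, r (j + 1) / r j) :=
          mul_le_mul_of_nonneg_left hamgm hk₀.le
      _ = _ := by rw [← mul_assoc, mul_one_div_cancel hk₀.ne', one_mul]
  rw [le_div_iff₀ hA, Real.div_rpow hB.le hA.le] at hle
  have hexp : ((k : ℝ) - 1) / k = 1 - 1 / k := by field_simp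
  rw [hexp, Real.rpow_sub hA, Real.rpow_one]
  refine le_of_eq_of_le ?_ hle
  ring

end ElementarySymmetric

theorem esymmDel_eq_esymmOn_erase (n m : ℕ) (i : Fin n) (x : Fin n → ℝ) :
    esymmDel n m i x = esymmOn (Finset.univ.erase i) m x := by
  have hcongr : esymmOn (Finset.univ.erase i) m (Function.update x i 0) =
      esymmOn (Finset.univ.erase i) m x :=
    esymmOn_congr m fun j hj => Function.update_of_ne (Finset.ne_of_mem_erase hj) _ _
  rw [← hcongr]
  change esymmOn Finset.univ m _ = _
  cases m with
  | zero => simp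
  | succ m => simp [esymmOn_succ_eq_erase (Finset.mem_univ i)]

/-- for `1 ≤ k ≤ n`, `λ ∈ Γ_k` and `μ` in the closure of `Γ_k`,
`Σ_i σ_{k-1;i}(λ) μ_i ≥ k σ_k(λ)^{(k-1)/k} σ_k(μ)^{1/k}`; in particular the left-hand
side is nonnegative. -/
theorem stmt18 (n k : ℕ) (hk : 1 ≤ k) (hkn : k ≤ n)
    (lam mu : Fin n → ℝ) (hlam : lam ∈ GardingCone n k)
    (hmu : mu ∈ closure (GardingCone n k)) :
    (∑ i : Fin n, esymmDel n (k - 1) i lam * mu i ≥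
      (k : ℝ) * (esymm n k lam) ^ (((k : ℝ) - 1) / k) * (esymm n k mu) ^ ((1 : ℝ) / k)) ∧
    0 ≤ ∑ i : Fin n, esymmDel n (k - 1) i lam * mu i := by
  have hsum : ∀ y : Fin n → ℝ, ∑ i : Fin n, esymmDel n (k - 1) i lam * y i =
      esymmOnDeriv Finset.univ k lam y := by
    intro y
    obtain ⟨m, rfl⟩ : ∃ m, k = m + 1 := ⟨k - 1, by omega⟩
    rw [Nat.add_sub_cancel]
    exact Finset.sum_congr rfl fun i _ => by rw [esymmDel_eq_esymmOn_erase, mul_comm]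
  have hpos : ∀ y ∈ GardingCone n k, ∀ j ≤ k, 0 < esymmOn Finset.univ j y := by
    intro y hy j hj
    rcases Nat.eq_zero_or_pos j with rfl | h
    · simp
    · exact hy j h hj
  have hcone : ∀ y ∈ GardingCone n k,
      (k : ℝ) * (esymm n k lam) ^ (((k : ℝ) - 1) / k) * (esymm n k y) ^ ((1 : ℝ) / k) ≤
        ∑ i : Fin n, esymmDel n (k - 1) i lam * y i := by
    intro y hy
    rw [hsum]
    exact mul_rpow_mul_rpow_le_esymmOnDeriv Finset.univ hk lam y (hpos lam hlam) (hpos y hy)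
  have hcont : Continuous fun y : Fin n → ℝ => ∑ i : Fin n, esymmDel n (k - 1) i lam * y i := by
    fun_prop
  have hcont' : Continuous fun y : Fin n → ℝ =>
      (k : ℝ) * (esymm n k lam) ^ (((k : ℝ) - 1) / k) * (esymm n k y) ^ ((1 : ℝ) / k) :=
    continuous_const.mul ((continuous_esymm n k).rpow_const fun _ => Or.inr (by positivity))
  refine ⟨closure_minimal hcone (isClosed_le hcont' hcont) hmu,
    closure_minimal (fun y hy => ?_) (isClosed_le continuous_const hcont) hmu⟩
  have h₁ := (hlam k hk le_rfl).le
  have h₂ := (hy k hk le_rfl).le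
  exact le_trans (by positivity) (hcone y hy)
end
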